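/- Fix δ > 0, β > 0 and γ ∈ (0, 1]. For every binary qubit POVM in conical coordinates (w, λ, θ, φ) with purity 2(1 + λ²)w² = γ, the Δ-disturbance satisfies D^{(Δ)} ≤ δ² √γ e^{2βδ} / ((1 + e^{βδ})² (1 + e^{βδ} − √γ)), and equality holds for the semiclassical POVM with λ = 1, θ = 0, w = √γ/2. -/

import Mathlib

open Matrix ComplexOrder Real

noncomputable def pauliX : Matrix (Fin 2) (Fin 2) ℂ := !![0, 1; 1, 0]
noncomputable def pauliY : Matrix (Fin 2) (Fin 2) ℂ := !![0, -Complex.I; Complex.I, 0]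
noncomputable def pauliZ : Matrix (Fin 2) (Fin 2) ℂ := !![1, 0; 0, -1]

/-- The thermal qubit state `ρ_β = diag(e^{−βδ/2}, e^{βδ/2})/(2 cosh(βδ/2))`. -/
noncomputable def rhoTherm (δ β : ℝ) : Matrix (Fin 2) (Fin 2) ℂ :=
  ((2 * Real.cosh (β * δ / 2) : ℝ)⁻¹ : ℂ) •
    !![Complex.exp (-(β * δ / 2)), 0; 0, Complex.exp (β * δ / 2)]

/-- The POVM element `Π₀` of a binary qubit POVM in conical coordinates. -/
noncomputable def povm0 (w l θ φ : ℝ) : Matrix (Fin 2) (Fin 2) ℂ :=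
  (w : ℂ) • ((1 : Matrix (Fin 2) (Fin 2) ℂ)
    + ((l * Real.sin θ * Real.cos φ : ℝ) : ℂ) • pauliX
    + ((l * Real.sin θ * Real.sin φ : ℝ) : ℂ) • pauliY
    + ((l * Real.cos θ : ℝ) : ℂ) • pauliZ)

/-- The POVM element `Π₁ = I₂ − Π₀`. -/
noncomputable def povm1 (w l θ φ : ℝ) : Matrix (Fin 2) (Fin 2) ℂ :=
  1 - povm0 w l θ φ

/-- The outcome probability `p₀(β) = tr(ρ_β Π₀)`. -/
noncomputable def prob0 (δ β w l θ φ : ℝ) : ℝ :=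
  ((rhoTherm δ β * povm0 w l θ φ).trace).re

/-- The Fisher information of the measurement, `F_β = (dp₀/dβ)²/(p₀ p₁)`. -/
noncomputable def fisherInfo (δ β w l θ φ : ℝ) : ℝ :=
  (deriv (fun b => prob0 δ b w l θ φ) β) ^ 2 /
    (prob0 δ β w l θ φ * (1 - prob0 δ β w l θ φ))
/-- The quantum Fisher information `F^Q = δ²/(2 + 2cosh(βδ))` of the thermal qubit model. -/
noncomputable def qfiModel (δ β : ℝ) : ℝ := δ ^ 2 / (2 + 2 * Real.cosh (β * δ))

/-- The QFI `Q₀` of the post-measurement state for outcome 0. -/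
noncomputable def qfiPost0 (δ β l θ : ℝ) : ℝ :=
  δ ^ 2 * (1 - l ^ 2) * Real.exp (β * δ) /
    ((1 + l * Real.cos θ) + Real.exp (β * δ) * (1 - l * Real.cos θ)) ^ 2

/-- The QFI `Q₁` of the post-measurement state for outcome 1. -/
noncomputable def qfiPost1 (δ β w l θ : ℝ) : ℝ :=
  δ ^ 2 * ((1 - w) ^ 2 - l ^ 2 * w ^ 2) * Real.exp (β * δ) /
    (1 - w * (1 + l * Real.cos θ) + Real.exp (β * δ) * (1 - w * (1 - l * Real.cos θ))) ^ 2

/-- The Δ-disturbance (information loss) `D^{(Δ)} = F^Q − p₀Q₀ − p₁Q₁`. -/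
noncomputable def deltaDist (δ β w l θ φ : ℝ) : ℝ :=
  qfiModel δ β - prob0 δ β w l θ φ * qfiPost0 δ β l θ -
    (1 - prob0 δ β w l θ φ) * qfiPost1 δ β w l θ
/-- The outcome probability `p₀` in terms of `e^{βδ}`. -/
theorem prob0_eq (δ β w l θ φ : ℝ) :
    prob0 δ β w l θ φ =
      w * ((1 + l * Real.cos θ) + Real.exp (β * δ) * (1 - l * Real.cos θ)) /
        (1 + Real.exp (β * δ)) := by
  have hE : Real.exp (β * δ) = Real.exp (β * δ / 2) ^ 2 := by
    rw [← Real.exp_nat_mul]; congr 1; push_cast; ring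
  have h1 : Complex.exp (-(β * δ / 2)) = ((Real.exp (-(β * δ / 2)) : ℝ) : ℂ) := by
    push_cast; rfl
  have h2 : Complex.exp (β * δ / 2) = ((Real.exp (β * δ / 2) : ℝ) : ℂ) := by
    push_cast; rfl
  have h3 : prob0 δ β w l θ φ = (2 * Real.cosh (β * δ / 2))⁻¹ *
      (Real.exp (-(β * δ / 2)) * (w * (1 + l * Real.cos θ)) +
        Real.exp (β * δ / 2) * (w * (1 - l * Real.cos θ))) := by
    rw [prob0, ← Complex.ofReal_re ((2 * Real.cosh (β * δ / 2))⁻¹ * _)]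
    congr 1
    rw [rhoTherm, povm0, h1, h2]
    simp [pauliX, pauliY, pauliZ, Matrix.trace_fin_two, Matrix.one_fin_two]
    ring
  rw [h3, hE, Real.cosh_eq, Real.exp_neg]
  have := Real.exp_pos (β * δ / 2)
  field_simp
  ring

theorem qfiModel_eq (δ β : ℝ) :
    qfiModel δ β = δ ^ 2 * Real.exp (β * δ) / (1 + Real.exp (β * δ)) ^ 2 := by
  have := Real.exp_pos (β * δ)
  have h : 2 + 2 * Real.cosh (β * δ) = (1 + Real.exp (β * δ)) ^ 2 / Real.exp (β * δ) := by
    rw [Real.cosh_eq, Real.exp_neg]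
    field_simp
    ring
  rw [qfiModel, h]
  field_simp

/-- The Δ-disturbance in terms of the unnormalised outcome weights. -/
theorem deltaDist_eq (δ β w l θ φ E K : ℝ) (hE : E = Real.exp (β * δ))
    (hK : K = (1 + l * Real.cos θ) + E * (1 - l * Real.cos θ))
    (hK0 : 0 < K) (hK1 : 0 < 1 + E - w * K) :
    deltaDist δ β w l θ φ = δ ^ 2 * E / (1 + E) *
      (1 / (1 + E) - (w * (1 - l ^ 2) / K + ((1 - w) ^ 2 - l ^ 2 * w ^ 2) / (1 + E - w * K))) := by
  have hE0 : 0 < E := hE ▸ Real.exp_pos _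
  have h1 : 1 - w * (1 + l * Real.cos θ) + E * (1 - w * (1 - l * Real.cos θ)) = 1 + E - w * K := by
    rw [hK]; ring
  rw [deltaDist, prob0_eq, qfiModel_eq, qfiPost0, qfiPost1, ← hE, h1, ← hK]
  have h2 : 1 - w * K / (1 + E) = (1 + E - w * K) / (1 + E) := by field_simp
  rw [h2]
  have : (1 + E) ≠ 0 := by positivity
  generalize 1 + E - w * K = L at *
  field_simp
  ring

/-- Here `m ≥ n` are the eigenvalues of the POVM element and `k` its unnormalised probability. -/
theorem povm_weight_ineq {m n E k : ℝ} (hE : 0 < E) (hm : 0 < m) (hn : 0 ≤ n) (hnm : n ≤ m)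
    (hmn : m + n ≤ 1) (hk : m + n * E ≤ k) (hk' : k < 1 + E) :
    (1 - m) / (1 + E - m) ≤ m * n / k + (1 - m) * (1 - n) / (1 + E - k) := by
  have hk0 : 0 < k := by nlinarith [mul_nonneg hn hE.le]
  have h1 : 0 < 1 + E - m := by linarith
  have h2 : 0 < 1 + E - k := by linarith
  rw [div_add_div _ _ hk0.ne' h2.ne', div_le_div_iff₀ h1 (by positivity)]
  obtain ⟨t, ht⟩ : ∃ t, k = m + n * E + t := ⟨k - m - n * E, by ring⟩
  have ht0 : 0 ≤ t := by linarith
  have h1m : 0 ≤ 1 - m := by linarith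
  have key : 0 ≤ n * m * (1 - n) * E ^ 2 + t * (n * E * (1 - 2 * m)) + (1 - m) * t ^ 2 := by
    have h1n : 0 ≤ 1 - n := by linarith
    rcases le_total m (1 / 2) with h | h
    · have : 0 ≤ 1 - 2 * m := by linarith
      positivity
    · rcases h1m.eq_or_lt with h0 | h0
      · have : n = 0 := by linarith
        simp [this, ← h0]
      · have hd : n ^ 2 * (2 * m - 1) ^ 2 ≤ 4 * (1 - m) * (n * m * (1 - n)) := by
          have a1 : n * n ≤ n * (1 - m) := by gcongr; linarith
          have a2 : (2 * m - 1) ^ 2 ≤ 4 * (m * (1 - n)) := by nlinarith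
          calc n ^ 2 * (2 * m - 1) ^ 2 = (n * n) * (2 * m - 1) ^ 2 := by ring
            _ ≤ (n * (1 - m)) * (4 * (m * (1 - n))) := by gcongr
            _ = _ := by ring
        have hp : 0 ≤ 4 * (1 - m) *
            (n * m * (1 - n) * E ^ 2 + t * (n * E * (1 - 2 * m)) + (1 - m) * t ^ 2) := by
          nlinarith [mul_le_mul_of_nonneg_right hd (sq_nonneg E),
            sq_nonneg (2 * (1 - m) * t + n * E * (1 - 2 * m))]
        exact nonneg_of_mul_nonneg_right hp (by linarith)
  have e1 : 0 ≤ n * E * ((1 - m) * (2 * m - n)) := by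
    have : 0 ≤ 2 * m - n := by linarith
    positivity
  have e2 : 0 ≤ t * ((m - n) * (1 - m)) := by
    have : 0 ≤ m - n := by linarith
    positivity
  subst ht
  linear_combination key + e1 + e2

/-- For fixed purity `γ`, the maximum Δ-disturbance is
`δ²√γ e^{2βδ}/((1+e^{βδ})²(1+e^{βδ}−√γ))`, attained by the semiclassical POVM with
`λ = 1`, `θ = 0`, `w = √γ/2`. -/
theorem stmt13 (δ β γ : ℝ) (hδ : 0 < δ) (hβ : 0 < β) (hγ : 0 < γ) (hγ' : γ ≤ 1) :
    (∀ w l θ φ : ℝ, 0 < w → w ≤ 1 / 2 → 0 ≤ l → l ≤ 1 →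
      0 ≤ θ → θ ≤ π → 0 ≤ φ → φ < 2 * π → 2 * (1 + l ^ 2) * w ^ 2 = γ →
      deltaDist δ β w l θ φ ≤
        δ ^ 2 * Real.sqrt γ * Real.exp (2 * β * δ) /
          ((1 + Real.exp (β * δ)) ^ 2 * (1 + Real.exp (β * δ) - Real.sqrt γ)))
    ∧ (∀ φ : ℝ, 0 ≤ φ → φ < 2 * π →
      deltaDist δ β (Real.sqrt γ / 2) 1 0 φ =
        δ ^ 2 * Real.sqrt γ * Real.exp (2 * β * δ) /
          ((1 + Real.exp (β * δ)) ^ 2 * (1 + Real.exp (β * δ) - Real.sqrt γ))) := by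
  have hEp : 1 < Real.exp (β * δ) := Real.one_lt_exp_iff.2 (mul_pos hβ hδ)
  have hE2 : Real.exp (2 * β * δ) = Real.exp (β * δ) ^ 2 := by
    rw [← Real.exp_nat_mul]; congr 1; push_cast; ring
  have hs0 : 0 < √γ := Real.sqrt_pos.2 hγ
  have hs1 : √γ ≤ 1 := Real.sqrt_le_one.2 hγ'
  rw [hE2]
  generalize hE : Real.exp (β * δ) = E at *
  generalize hs : √γ = s at *
  have hS : 0 < 1 + E - s := by linarith
  have target : δ ^ 2 * s * E ^ 2 / ((1 + E) ^ 2 * (1 + E - s)) =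
      δ ^ 2 * E / (1 + E) * (1 / (1 + E) - (1 - s) / (1 + E - s)) := by
    have : 1 + E ≠ 0 := by linarith
    field_simp
    ring
  constructor
  · intro w l θ φ hw hw' hl hl' _ _ _ _ hg
    have hc := Real.cos_le_one θ
    have hc' := Real.neg_one_le_cos θ
    have hx : l * Real.cos θ ≤ l := mul_le_of_le_one_right hl hc
    have hx' : -l ≤ l * Real.cos θ := by nlinarith
    generalize hK : (1 + l * Real.cos θ) + E * (1 - l * Real.cos θ) = K
    have hK0 : 0 < K := by rw [← hK]; nlinarith
    have hK2 : K ≤ 2 * E := by rw [← hK]; nlinarith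
    have hK1 : w * K < 1 + E := by
      linarith [mul_le_mul_of_nonneg_right hw' hK0.le]
    rw [deltaDist_eq δ β w l θ φ E K hE.symm hK.symm hK0 (by linarith), target]
    have hms : w * (1 + l) ≤ s := by
      rw [← hs]
      apply Real.le_sqrt_of_sq_le
      rw [← hg]
      nlinarith [mul_nonneg (sq_nonneg w) (sq_nonneg (1 - l))]
    have hm := povm_weight_ineq (m := w * (1 + l)) (n := w * (1 - l)) (E := E) (k := w * K)
      (by linarith) (by positivity) (mul_nonneg hw.le (by linarith)) (by gcongr; linarith) (by linarith)
      (by rw [← hK]; linarith [mul_nonneg hw.le (mul_nonneg (sub_nonneg.2 hx) (sub_nonneg.2 hEp.le))])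
      hK1
    have e1 : w * (1 + l) * (w * (1 - l)) / (w * K) = w * (1 - l ^ 2) / K := by
      field_simp
      ring
    have e2 : (1 - w * (1 + l)) * (1 - w * (1 - l)) = (1 - w) ^ 2 - l ^ 2 * w ^ 2 := by ring
    rw [e1, e2] at hm
    have hmono : (1 - s) / (1 + E - s) ≤ (1 - w * (1 + l)) / (1 + E - w * (1 + l)) := by
      rw [div_le_div_iff₀ hS (by linarith)]
      linarith [mul_le_mul_of_nonneg_right hms (zero_lt_one.trans hEp).le]
    have : 0 ≤ δ ^ 2 * E / (1 + E) := by positivity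
    gcongr
    exact hmono.trans hm
  · intro φ _ _
    rw [deltaDist_eq δ β (s / 2) 1 0 φ E 2 hE.symm (by simp; norm_num) two_pos (by linarith), target]
    congr 2
    have : 1 + E - s / 2 * 2 = 1 + E - s := by ring
    rw [this]
    ring
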